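/- arXiv:2001.10087 — 2 statements merged into one kernel-verified Lean document; each statement's English description precedes it below -/
import Mathlib

section
/- The (2,2)-3SAT formula φ is satisfiable if and only if the constructed SMI-Diverse instance admits a feasible and stable matching. -/
open scoped Classical

noncomputable section

/-- An SMTI-Diverse instance: students `S`, colleges `C`, types `T`.
Preferences are encoded by rank functions (smaller rank = more preferred);
ties are allowed.  `acc` is the (symmetric) acceptability relation, `tau`
the 0/1 type vectors (encoded as `Bool`), `lq`/`uq` the lower/upper quota
vectors and `cap` the capacities. -/
structure SMTI (S C T : Type) [Fintype S] [Fintype C] [Fintype T] where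
  acc : S → C → Prop
  tau : S → T → Bool
  rankS : S → C → ℕ
  rankC : C → S → ℕ
  lq : C → T → ℕ
  uq : C → T → ℕ
  cap : C → ℕ

namespace SMTI

variable {S C T : Type} [Fintype S] [Fintype C] [Fintype T]

/-- `f : S → Option C` encodes a matching: every assigned college is acceptable. -/
def IsMatching (I : SMTI S C T) (f : S → Option C) : Prop :=
  ∀ u w, f u = some w → I.acc u w

/-- The set `M(w)` of students assigned to college `w`. -/
def assigned (I : SMTI S C T) (f : S → Option C) (w : C) : Finset S :=
  Finset.univ.filter fun u => f u = some w

/-- The number of students of type `z` assigned to `w`. -/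
def typeLoad (I : SMTI S C T) (f : S → Option C) (w : C) (z : T) : ℕ :=
  ∑ u ∈ I.assigned f w, (I.tau u z).toNat

/-- Feasibility: capacities respected and quotas met at all colleges. -/
def Feasible (I : SMTI S C T) (f : S → Option C) : Prop :=
  ∀ w, (I.assigned f w).card ≤ I.cap w ∧
    ∀ z, I.lq w z ≤ I.typeLoad f w z ∧ I.typeLoad f w z ≤ I.uq w z

/-- `u` strictly prefers `w` to its assigned college (in particular if unmatched). -/
def PrefersTo (I : SMTI S C T) (f : S → Option C) (u : S) (w : C) : Prop :=
  ∀ w', f u = some w' → I.rankS u w < I.rankS u w'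

/-- `{u,w}` is a blocking pair of `f` witnessed by `U' ⊆ M(w)`. -/
def BlocksWith (I : SMTI S C T) (f : S → Option C) (u : S) (w : C) (U' : Finset S) : Prop :=
  f u ≠ some w ∧ I.acc u w ∧ I.PrefersTo f u w ∧
  U' ⊆ I.assigned f w ∧
  (∀ u' ∈ U', I.rankC w u < I.rankC w u') ∧
  (I.assigned f w \ U').card + 1 ≤ I.cap w ∧
  ∀ z, I.lq w z ≤ (I.tau u z).toNat + ∑ u' ∈ I.assigned f w \ U', (I.tau u' z).toNat ∧
    (I.tau u z).toNat + ∑ u' ∈ I.assigned f w \ U', (I.tau u' z).toNat ≤ I.uq w z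

/-- `{u,w}` is a blocking pair of `f` (with some witness). -/
def BlockingPair (I : SMTI S C T) (f : S → Option C) (u : S) (w : C) : Prop :=
  ∃ U', I.BlocksWith f u w U'

/-- Stability: no blocking pair at all. -/
def Stable (I : SMTI S C T) (f : S → Option C) : Prop :=
  ∀ u w, ¬ I.BlockingPair f u w

end SMTI

section TwoTwo3SAT

/-- Students: for each variable `i`, the variable students `x_i = Sum.inl (i, Sum.inl 0)`,
`y_i = Sum.inl (i, Sum.inl 1)` and the literal students
`u_i^z = Sum.inl (i, Sum.inr (true, z))`, `v_i^z = Sum.inl (i, Sum.inr (false, z))`;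
plus the special students `r1 = Sum.inr 0`, `r2 = Sum.inr 1`, `r3 = Sum.inr 2`. -/
abbrev TSt (r : ℕ) := (Fin r × (Fin 2 ⊕ Bool × Fin 2)) ⊕ Fin 3

/-- Colleges: variable colleges `w_i = Sum.inl (i, 0)`, `p_i = Sum.inl (i, 1)`,
clause colleges `c_j = Sum.inr (Sum.inl j)` and special colleges
`a = Sum.inr (Sum.inr 0)`, `b = Sum.inr (Sum.inr 1)`. -/
abbrev TCo (r s : ℕ) := (Fin r × Fin 2) ⊕ (Fin s ⊕ Fin 2)

/-- The literal student sitting in slot `(j, zz)` (the `z`-th literal of clause `j`). -/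
def slotSt (r s : ℕ) (occ : Bool × Fin r × Fin 2 ≃ Fin s × Fin 3)
    (j : Fin s) (zz : Fin 3) : TSt r :=
  Sum.inl ((occ.symm (j, zz)).2.1, Sum.inr ((occ.symm (j, zz)).1, (occ.symm (j, zz)).2.2))

/-- The SMI-Diverse instance constructed from a (2,2)-3SAT formula (encoded by the
bijection `occ` between literal occurrences and clause slots). -/
def TInst (r s : ℕ) (occ : Bool × Fin r × Fin 2 ≃ Fin s × Fin 3) :
    SMTI (TSt r) (TCo r s) (Fin 2) where
  acc := fun st c =>
    match st with
    | Sum.inl (i, Sum.inl _) => c = Sum.inl (i, 0) ∨ c = Sum.inl (i, 1)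
    | Sum.inl (i, Sum.inr (pol, z)) =>
        c = Sum.inl (i, if pol then 0 else 1) ∨ c = Sum.inr (Sum.inl (occ (pol, i, z)).1)
    | Sum.inr k =>
        if k = 1 then
          (c = Sum.inr (Sum.inr 0) ∨ c = Sum.inr (Sum.inr 1) ∨
            ∃ j : Fin s, c = Sum.inr (Sum.inl j))
        else (c = Sum.inr (Sum.inr 0) ∨ c = Sum.inr (Sum.inr 1))
  tau := fun st z =>
    match st with
    | Sum.inl (_, Sum.inl k) => if k = 0 then decide (z = 0) else decide (z = 1)
    | Sum.inl (_, Sum.inr (_, zz)) => if zz = 0 then true else false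
    | Sum.inr k => if k = 0 then decide (z = 0) else if k = 1 then true else decide (z = 1)
  rankS := fun st c =>
    match st with
    | Sum.inl (i, Sum.inl k) =>
        -- x_i : p_i ≻ w_i ;  y_i : w_i ≻ p_i
        if k = 0 then (if c = Sum.inl (i, 1) then 0 else if c = Sum.inl (i, 0) then 1 else 9)
        else (if c = Sum.inl (i, 0) then 0 else if c = Sum.inl (i, 1) then 1 else 9)
    | Sum.inl (i, Sum.inr (pol, z)) =>
        -- u_i^z : w_i ≻ c[u_i^z] ;  v_i^z : p_i ≻ c[v_i^z]
        if c = Sum.inl (i, if pol then 0 else 1) then 0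
        else if c = Sum.inr (Sum.inl (occ (pol, i, z)).1) then 1 else 9
    | Sum.inr k =>
        if k = 0 then
          -- r1 : b ≻ a
          (if c = Sum.inr (Sum.inr 1) then 0 else if c = Sum.inr (Sum.inr 0) then 1 else 9)
        else if k = 1 then
          -- r2 : b ≻ c_1 ≻ ⋯ ≻ c_s ≻ a
          (if c = Sum.inr (Sum.inr 1) then 0
           else match c with
                | Sum.inr (Sum.inl j) => 1 + (j : ℕ)
                | Sum.inr (Sum.inr _) => 1 + s
                | _ => 9 + s)
        else
          -- r3 : a ≻ b
          (if c = Sum.inr (Sum.inr 0) then 0 else if c = Sum.inr (Sum.inr 1) then 1 else 9)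
  rankC := fun c st =>
    match c with
    | Sum.inl (i, k) =>
        if k = 0 then
          -- w_i : x_i ≻ u_i^1 ≻ y_i ≻ u_i^2
          (if st = Sum.inl (i, Sum.inl 0) then 0
           else if st = Sum.inl (i, Sum.inr (true, 0)) then 1
           else if st = Sum.inl (i, Sum.inl 1) then 2
           else if st = Sum.inl (i, Sum.inr (true, 1)) then 3 else 9)
        else
          -- p_i : y_i ≻ v_i^1 ≻ x_i ≻ v_i^2
          (if st = Sum.inl (i, Sum.inl 1) then 0
           else if st = Sum.inl (i, Sum.inr (false, 0)) then 1
           else if st = Sum.inl (i, Sum.inl 0) then 2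
           else if st = Sum.inl (i, Sum.inr (false, 1)) then 3 else 9)
    | Sum.inr (Sum.inl j) =>
        -- c_j : s^1[c_j] ≻ s^2[c_j] ≻ s^3[c_j] ≻ r2
        if st = slotSt r s occ j 0 then 0
        else if st = slotSt r s occ j 1 then 1
        else if st = slotSt r s occ j 2 then 2
        else if st = Sum.inr 1 then 3 else 9
    | Sum.inr (Sum.inr k) =>
        if k = 0 then
          -- a : r1 ≻ r2 ≻ r3
          (if st = Sum.inr 0 then 0 else if st = Sum.inr 1 then 1
           else if st = Sum.inr 2 then 2 else 9)
        else
          -- b : r3 ≻ r2 ≻ r1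
          (if st = Sum.inr 2 then 0 else if st = Sum.inr 1 then 1
           else if st = Sum.inr 0 then 2 else 9)
  lq := fun _ _ => 0
  uq := fun _ _ => 1
  cap := fun c =>
    match c with
    | Sum.inl _ => 2
    | Sum.inr (Sum.inl _) => 1
    | Sum.inr (Sum.inr k) => if k = 0 then 1 else 2

end TwoTwo3SAT

section Helpers

/-- In a stable matching no pair can block while keeping (at most) the students in `K`. -/
theorem SMTI.block_of {S C T : Type} [Fintype S] [Fintype C] [Fintype T] (I : SMTI S C T)
    {f : S → Option C} (hs : I.Stable f) (hl : ∀ w z, I.lq w z = 0) (K : Finset S) (u : S) (w : C)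
    (hf : f u ≠ some w) (hacc : I.acc u w) (hp : I.PrefersTo f u w)
    (hK : ∀ u', f u' = some w → u' ∉ K → I.rankC w u < I.rankC w u')
    (hc : K.card + 1 ≤ I.cap w)
    (hq : ∀ z, (I.tau u z).toNat + ∑ u' ∈ K, (I.tau u' z).toNat ≤ I.uq w z) : False := by
  have hsub : I.assigned f w \ (I.assigned f w \ K) ⊆ K := by
    intro a ha
    simp only [Finset.mem_sdiff] at ha
    tauto
  refine hs u w ⟨I.assigned f w \ K, hf, hacc, hp, Finset.sdiff_subset, ?_, ?_, ?_⟩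
  · intro u' hu'
    simp only [SMTI.assigned, Finset.mem_sdiff, Finset.mem_filter, Finset.mem_univ,
      true_and] at hu'
    exact hK u' hu'.1 hu'.2
  · have := Finset.card_le_card hsub
    omega
  · intro z
    rw [hl]
    refine ⟨Nat.zero_le _, le_trans ?_ (hq z)⟩
    have := Finset.sum_le_sum_of_subset (f := fun u' => (I.tau u' z).toNat) hsub
    omega

/-- A blocking pair must keep every assigned student that is weakly preferred. -/
theorem SMTI.keep_of_blocks {S C T : Type} [Fintype S] [Fintype C] [Fintype T] (I : SMTI S C T)
    {f : S → Option C} {u : S} {w : C} (h : I.BlockingPair f u w) (K : Finset S)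
    (hK : ∀ u' ∈ K, f u' = some w ∧ I.rankC w u' ≤ I.rankC w u) :
    K.card + 1 ≤ I.cap w ∧
      ∀ z, (I.tau u z).toNat + ∑ u' ∈ K, (I.tau u' z).toNat ≤ I.uq w z := by
  obtain ⟨U', -, -, -, hU, hr, hc, hq⟩ := h
  have hsub : K ⊆ I.assigned f w \ U' := by
    intro a ha
    simp only [SMTI.assigned, Finset.mem_sdiff, Finset.mem_filter, Finset.mem_univ, true_and]
    refine ⟨(hK a ha).1, fun h => ?_⟩
    have h1 := hr a h
    have h2 := (hK a ha).2
    omega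
  refine ⟨?_, fun z => ?_⟩
  · have := Finset.card_le_card hsub
    omega
  · have := Finset.sum_le_sum_of_subset (f := fun u' => (I.tau u' z).toNat) hsub
    have := (hq z).2
    omega

/-- Lower bound on loads coming from a set of assigned students. -/
theorem SMTI.load_of_feasible {S C T : Type} [Fintype S] [Fintype C] [Fintype T] (I : SMTI S C T)
    {f : S → Option C} (h : I.Feasible f) (w : C) (K : Finset S) (hK : ∀ u' ∈ K, f u' = some w) :
    K.card ≤ I.cap w ∧ ∀ z, ∑ u' ∈ K, (I.tau u' z).toNat ≤ I.uq w z := by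
  have hsub : K ⊆ I.assigned f w := by
    intro a ha
    simpa [SMTI.assigned] using hK a ha
  refine ⟨(Finset.card_le_card hsub).trans (h w).1, fun z => ?_⟩
  exact (Finset.sum_le_sum_of_subset (f := fun u' => (I.tau u' z).toNat) hsub).trans ((h w).2 z).2

/-- Feasibility from explicit supersets. -/
theorem SMTI.feasible_of {S C T : Type} [Fintype S] [Fintype C] [Fintype T] (I : SMTI S C T)
    {f : S → Option C} (hl : ∀ w z, I.lq w z = 0)
    (h : ∀ w, ∃ K : Finset S, (∀ u, f u = some w → u ∈ K) ∧ K.card ≤ I.cap w ∧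
      ∀ z, ∑ u' ∈ K, (I.tau u' z).toNat ≤ I.uq w z) : I.Feasible f := by
  intro w
  obtain ⟨K, hK, hc, hq⟩ := h w
  have hsub : I.assigned f w ⊆ K := by
    intro a ha
    exact hK a (by simpa [SMTI.assigned] using ha)
  refine ⟨(Finset.card_le_card hsub).trans hc, fun z => ⟨by simp [hl], ?_⟩⟩
  exact (Finset.sum_le_sum_of_subset (f := fun u' => (I.tau u' z).toNat) hsub).trans (hq z)

variable {r s : ℕ} {occ : Bool × Fin r × Fin 2 ≃ Fin s × Fin 3}

theorem acc_w {u : TSt r} {i : Fin r} (h : (TInst r s occ).acc u (Sum.inl (i, 0))) :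
    u = Sum.inl (i, Sum.inl 0) ∨ u = Sum.inl (i, Sum.inl 1) ∨
    u = Sum.inl (i, Sum.inr (true, 0)) ∨ u = Sum.inl (i, Sum.inr (true, 1)) := by
  rcases u with ⟨i', k | ⟨pol, z⟩⟩ | k
  · fin_cases k <;> simp [TInst] at h ⊢ <;> simp [h]
  · cases pol <;> fin_cases z <;> simp [TInst] at h ⊢ <;> simp [h]
  · fin_cases k <;> simp [TInst] at h

theorem acc_p {u : TSt r} {i : Fin r} (h : (TInst r s occ).acc u (Sum.inl (i, 1))) :
    u = Sum.inl (i, Sum.inl 0) ∨ u = Sum.inl (i, Sum.inl 1) ∨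
    u = Sum.inl (i, Sum.inr (false, 0)) ∨ u = Sum.inl (i, Sum.inr (false, 1)) := by
  rcases u with ⟨i', k | ⟨pol, z⟩⟩ | k
  · fin_cases k <;> simp [TInst] at h ⊢ <;> simp [h]
  · cases pol <;> fin_cases z <;> simp [TInst] at h ⊢ <;> simp [h]
  · fin_cases k <;> simp [TInst] at h

theorem acc_c {u : TSt r} {j : Fin s} (h : (TInst r s occ).acc u (Sum.inr (Sum.inl j))) :
    u = Sum.inr 1 ∨ ∃ pol i z, (occ (pol, i, z)).1 = j ∧ u = Sum.inl (i, Sum.inr (pol, z)) := by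
  rcases u with ⟨i', k | ⟨pol, z⟩⟩ | k
  · simp [TInst] at h
  · simp [TInst] at h
    right
    exact ⟨pol, i', z, h.symm, rfl⟩
  · fin_cases k <;> simp [TInst] at h ⊢

theorem acc_s {u : TSt r} {k : Fin 2} (h : (TInst r s occ).acc u (Sum.inr (Sum.inr k))) :
    u = Sum.inr 0 ∨ u = Sum.inr 1 ∨ u = Sum.inr 2 := by
  rcases u with ⟨i', k | ⟨pol, z⟩⟩ | k
  · simp [TInst] at h
  · simp [TInst] at h
  · fin_cases k <;> simp

/-- In any feasible stable matching `r2` is assigned to `a`. -/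
theorem r2_at_a {f : TSt r → Option (TCo r s)} (hm : (TInst r s occ).IsMatching f)
    (hf : (TInst r s occ).Feasible f) (hs : (TInst r s occ).Stable f) :
    f (Sum.inr 1) = some (Sum.inr (Sum.inr 0)) := by
  have hl : ∀ w z, (TInst r s occ).lq w z = 0 := fun _ _ => rfl
  have A0 : ∀ k, f (Sum.inr 0) = some k → k = Sum.inr (Sum.inr 0) ∨ k = Sum.inr (Sum.inr 1) := by
    intro k hk
    simpa [TInst] using hm _ _ hk
  have A2 : ∀ k, f (Sum.inr 2) = some k → k = Sum.inr (Sum.inr 0) ∨ k = Sum.inr (Sum.inr 1) := by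
    intro k hk
    simpa [TInst] using hm _ _ hk
  by_contra hna
  by_cases hb : f (Sum.inr 1) = some (Sum.inr (Sum.inr 1))
  · have h0 : f (Sum.inr 0) ≠ some (Sum.inr (Sum.inr 1)) := by
      intro h
      have := (SMTI.load_of_feasible _ hf (Sum.inr (Sum.inr 1)) {Sum.inr 0, Sum.inr 1}
        (by simp [h, hb])).2 0
      simp [TInst] at this
    have h2 : f (Sum.inr 2) ≠ some (Sum.inr (Sum.inr 1)) := by
      intro h
      have := (SMTI.load_of_feasible _ hf (Sum.inr (Sum.inr 1)) {Sum.inr 2, Sum.inr 1}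
        (by simp [h, hb])).2 1
      simp [TInst] at this
    by_cases h2a : f (Sum.inr 2) = some (Sum.inr (Sum.inr 0))
    · have h0a : f (Sum.inr 0) ≠ some (Sum.inr (Sum.inr 0)) := by
        intro h
        have := (SMTI.load_of_feasible _ hf (Sum.inr (Sum.inr 0)) {Sum.inr 0, Sum.inr 2}
          (by simp [h, h2a])).1
        simp [TInst] at this
      refine SMTI.block_of _ hs hl ∅ (Sum.inr 0) (Sum.inr (Sum.inr 0)) h0a ?_ ?_ ?_ ?_ ?_
      · simp [TInst]
      · intro k hk
        rcases A0 k hk with rfl | rfl <;> simp_all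
      · intro u' hu' _
        rcases acc_s (hm _ _ hu') with rfl | rfl | rfl
        · exact absurd hu' h0a
        · exact absurd hu' hna
        · simp [TInst]
      · simp [TInst]
      · intro z; fin_cases z <;> simp [TInst]
    · refine SMTI.block_of _ hs hl ∅ (Sum.inr 2) (Sum.inr (Sum.inr 1)) h2 ?_ ?_ ?_ ?_ ?_
      · simp [TInst]
      · intro k hk
        rcases A2 k hk with rfl | rfl <;> simp_all
      · intro u' hu' _
        rcases acc_s (hm _ _ hu') with rfl | rfl | rfl
        · exact absurd hu' h0
        · simp [TInst]
        · exact absurd hu' h2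
      · simp [TInst]
      · intro z; fin_cases z <;> simp [TInst]
  · have h2a : f (Sum.inr 2) = some (Sum.inr (Sum.inr 0)) := by
      by_contra h2
      by_cases h0 : f (Sum.inr 0) = some (Sum.inr (Sum.inr 0))
      · refine SMTI.block_of _ hs hl {Sum.inr 2} (Sum.inr 0) (Sum.inr (Sum.inr 1)) ?_ ?_ ?_ ?_ ?_ ?_
        · simp [h0]
        · simp [TInst]
        · intro k hk
          rw [h0] at hk
          cases hk
          simp [TInst]
        · intro u' hu' hn
          rcases acc_s (hm _ _ hu') with rfl | rfl | rfl
          · simp [h0] at hu'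
          · exact absurd hu' hb
          · simp at hn
        · simp [TInst]
        · intro z; fin_cases z <;> simp [TInst]
      · refine SMTI.block_of _ hs hl ∅ (Sum.inr 2) (Sum.inr (Sum.inr 0)) h2 ?_ ?_ ?_ ?_ ?_
        · simp [TInst]
        · intro k hk
          rcases A2 k hk with rfl | rfl
          · exact absurd hk h2
          · simp [TInst]
        · intro u' hu' hn
          rcases acc_s (hm _ _ hu') with rfl | rfl | rfl
          · exact absurd hu' h0
          · exact absurd hu' hna
          · exact absurd hu' h2
        · simp [TInst]
        · intro z; fin_cases z <;> simp [TInst]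
    refine SMTI.block_of _ hs hl ∅ (Sum.inr 1) (Sum.inr (Sum.inr 1)) hb ?_ ?_ ?_ ?_ ?_
    · simp [TInst]
    · intro k hk
      have := hm _ _ hk
      simp only [TInst, if_true] at this
      rcases this with rfl | rfl | ⟨j, rfl⟩
      · exact absurd hk hna
      · exact absurd hk hb
      · simp [TInst]
    · intro u' hu' hn
      rcases acc_s (hm _ _ hu') with rfl | rfl | rfl
      · simp [TInst]
      · exact absurd hu' hb
      · simp [h2a] at hu'
    · simp [TInst]
    · intro z; fin_cases z <;> simp [TInst]

/-- In any feasible stable matching every clause college gets a literal student. -/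
theorem clause_filled {f : TSt r → Option (TCo r s)} (hm : (TInst r s occ).IsMatching f)
    (hf : (TInst r s occ).Feasible f) (hs : (TInst r s occ).Stable f) (j : Fin s) :
    ∃ pol i z, (occ (pol, i, z)).1 = j ∧
      f (Sum.inl (i, Sum.inr (pol, z))) = some (Sum.inr (Sum.inl j)) := by
  have hl : ∀ w z, (TInst r s occ).lq w z = 0 := fun _ _ => rfl
  have h1 := r2_at_a hm hf hs
  by_contra hne
  refine SMTI.block_of _ hs hl ∅ (Sum.inr 1) (Sum.inr (Sum.inl j)) ?_ ?_ ?_ ?_ ?_ ?_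
  · simp [h1]
  · simp [TInst]
  · intro k hk
    rw [h1] at hk
    cases hk
    simp [TInst]
  · intro u' hu' _
    rcases acc_c (hm _ _ hu') with rfl | ⟨pol, i, z, h, rfl⟩
    · simp [h1] at hu'
    · exact absurd ⟨pol, i, z, h, hu'⟩ hne
  · simp [TInst]
  · intro z; fin_cases z <;> simp [TInst]

/-- If a positive literal student is at its clause college, then `x_i` is at `w_i`. -/
theorem pos_case {f : TSt r → Option (TCo r s)} (hm : (TInst r s occ).IsMatching f)
    (hf : (TInst r s occ).Feasible f) (hs : (TInst r s occ).Stable f) (i : Fin r) (z : Fin 2)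
    (j : Fin s) (hu : f (Sum.inl (i, Sum.inr (true, z))) = some (Sum.inr (Sum.inl j))) :
    f (Sum.inl (i, Sum.inl 0)) = some (Sum.inl (i, 0)) := by
  have hl : ∀ w z, (TInst r s occ).lq w z = 0 := fun _ _ => rfl
  by_contra hx
  have hy : f (Sum.inl (i, Sum.inl 1)) ≠ some (Sum.inl (i, 0)) := by
    intro hy
    have hu1 : f (Sum.inl (i, Sum.inr (true, 0))) ≠ some (Sum.inl (i, 0)) := by
      intro h
      have := (SMTI.load_of_feasible _ hf (Sum.inl (i, 0))
        {Sum.inl (i, Sum.inl 1), Sum.inl (i, Sum.inr (true, 0))} (by simp [h, hy])).2 1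
      simp [TInst] at this
    refine SMTI.block_of _ hs hl ∅ (Sum.inl (i, Sum.inr (true, 0))) (Sum.inl (i, 0))
      hu1 ?_ ?_ ?_ ?_ ?_
    · simp [TInst]
    · intro k hk
      rcases hm _ _ hk with rfl | rfl
      · exact absurd hk hu1
      · simp [TInst]
    · intro u' hu' _
      rcases acc_w (hm _ _ hu') with rfl | rfl | rfl | rfl
      · exact absurd hu' hx
      · simp [TInst]
      · exact absurd hu' hu1
      · simp [TInst]
    · simp [TInst]
    · intro z; fin_cases z <;> simp [TInst]
  have hu1 : f (Sum.inl (i, Sum.inr (true, 0))) = some (Sum.inl (i, 0)) := by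
    by_contra hu1
    refine SMTI.block_of _ hs hl ∅ (Sum.inl (i, Sum.inl 1)) (Sum.inl (i, 0)) hy ?_ ?_ ?_ ?_ ?_
    · simp [TInst]
    · intro k hk
      rcases hm _ _ hk with rfl | rfl
      · exact absurd hk hy
      · simp [TInst]
    · intro u' hu' _
      rcases acc_w (hm _ _ hu') with rfl | rfl | rfl | rfl
      · exact absurd hu' hx
      · exact absurd hu' hy
      · exact absurd hu' hu1
      · simp [TInst]
    · simp [TInst]
    · intro z; fin_cases z <;> simp [TInst]
  fin_cases z
  · simp [hu1] at hu
  · replace hu : f (Sum.inl (i, Sum.inr (true, 1))) = some (Sum.inr (Sum.inl j)) := hu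
    refine SMTI.block_of _ hs hl {Sum.inl (i, Sum.inr (true, 0))} (Sum.inl (i, Sum.inr (true, 1)))
      (Sum.inl (i, 0)) ?_ ?_ ?_ ?_ ?_ ?_
    · simp [hu]
    · simp [TInst]
    · intro k hk
      rcases hm _ _ hk with rfl | rfl
      · simp [hu] at hk
      · simp [TInst]
    · intro u' hu' hn
      rcases acc_w (hm _ _ hu') with rfl | rfl | rfl | rfl
      · exact absurd hu' hx
      · exact absurd hu' hy
      · simp at hn
      · simp [hu] at hu'
    · simp [TInst]
    · intro z; fin_cases z <;> simp [TInst]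

/-- If a negative literal student is at its clause college, then `x_i` is not at `w_i`. -/
theorem neg_case {f : TSt r → Option (TCo r s)} (hm : (TInst r s occ).IsMatching f)
    (hf : (TInst r s occ).Feasible f) (hs : (TInst r s occ).Stable f) (i : Fin r) (z : Fin 2)
    (j : Fin s) (hu : f (Sum.inl (i, Sum.inr (false, z))) = some (Sum.inr (Sum.inl j))) :
    f (Sum.inl (i, Sum.inl 0)) ≠ some (Sum.inl (i, 0)) := by
  have hl : ∀ w z, (TInst r s occ).lq w z = 0 := fun _ _ => rfl
  intro hx
  have hxp : f (Sum.inl (i, Sum.inl 0)) ≠ some (Sum.inl (i, 1)) := by simp [hx]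
  have hpref : (TInst r s occ).PrefersTo f (Sum.inl (i, Sum.inl 0)) (Sum.inl (i, 1)) := by
    intro k hk
    rw [hx] at hk
    cases hk
    simp [TInst]
  have hy : f (Sum.inl (i, Sum.inl 1)) ≠ some (Sum.inl (i, 1)) := by
    intro hy
    have hu1 : f (Sum.inl (i, Sum.inr (false, 0))) ≠ some (Sum.inl (i, 1)) := by
      intro h
      have := (SMTI.load_of_feasible _ hf (Sum.inl (i, 1))
        {Sum.inl (i, Sum.inl 1), Sum.inl (i, Sum.inr (false, 0))} (by simp [h, hy])).2 1
      simp [TInst] at this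
    refine SMTI.block_of _ hs hl {Sum.inl (i, Sum.inl 1)} (Sum.inl (i, Sum.inl 0)) (Sum.inl (i, 1))
      hxp ?_ hpref ?_ ?_ ?_
    · simp [TInst]
    · intro u' hu' hn
      rcases acc_p (hm _ _ hu') with rfl | rfl | rfl | rfl
      · exact absurd hu' hxp
      · simp at hn
      · exact absurd hu' hu1
      · simp [TInst]
    · simp [TInst]
    · intro z; fin_cases z <;> simp [TInst]
  have hu1 : f (Sum.inl (i, Sum.inr (false, 0))) = some (Sum.inl (i, 1)) := by
    by_contra hu1
    refine SMTI.block_of _ hs hl ∅ (Sum.inl (i, Sum.inl 0)) (Sum.inl (i, 1)) hxp ?_ hpref ?_ ?_ ?_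
    · simp [TInst]
    · intro u' hu' _
      rcases acc_p (hm _ _ hu') with rfl | rfl | rfl | rfl
      · exact absurd hu' hxp
      · exact absurd hu' hy
      · exact absurd hu' hu1
      · simp [TInst]
    · simp [TInst]
    · intro z; fin_cases z <;> simp [TInst]
  fin_cases z
  · simp [hu1] at hu
  · replace hu : f (Sum.inl (i, Sum.inr (false, 1))) = some (Sum.inr (Sum.inl j)) := hu
    refine SMTI.block_of _ hs hl {Sum.inl (i, Sum.inr (false, 0))}
      (Sum.inl (i, Sum.inr (false, 1))) (Sum.inl (i, 1)) ?_ ?_ ?_ ?_ ?_ ?_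
    · simp [hu]
    · simp [TInst]
    · intro k hk
      rcases hm _ _ hk with rfl | rfl
      · simp [hu] at hk
      · simp [TInst]
    · intro u' hu' hn
      rcases acc_p (hm _ _ hu') with rfl | rfl | rfl | rfl
      · exact absurd hu' hxp
      · exact absurd hu' hy
      · simp at hn
      · simp [hu] at hu'
    · simp [TInst]
    · intro z; fin_cases z <;> simp [TInst]

/-- The matching built from an assignment `σ` and a choice `m` of a true slot per clause. -/
def buildM (occ : Bool × Fin r × Fin 2 ≃ Fin s × Fin 3) (σ : Fin r → Bool) (m : Fin s → Fin 3) :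
    TSt r → Option (TCo r s)
  | Sum.inl (i, Sum.inl _) => some (Sum.inl (i, if σ i then 0 else 1))
  | Sum.inl (i, Sum.inr (pol, z)) =>
      if σ i = pol then
        (if m (occ (pol, i, z)).1 = (occ (pol, i, z)).2 then
          some (Sum.inr (Sum.inl (occ (pol, i, z)).1)) else none)
      else some (Sum.inl (i, if pol then 0 else 1))
  | Sum.inr k => if k = 1 then some (Sum.inr (Sum.inr 0)) else some (Sum.inr (Sum.inr 1))

theorem buildM_matching (σ : Fin r → Bool) (m : Fin s → Fin 3) :
    (TInst r s occ).IsMatching (buildM occ σ m) := by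
  intro u w h
  rcases u with ⟨i', k | ⟨pol, z⟩⟩ | k
  · simp only [buildM, Option.some.injEq] at h
    subst h
    cases σ i' <;> simp [TInst]
  · simp only [buildM] at h
    split_ifs at h <;> simp_all [TInst]
  · simp only [buildM] at h
    split_ifs at h <;> simp_all [TInst]
    

theorem rank_slot (o : Bool × Fin r × Fin 2) :
    (TInst r s occ).rankC (Sum.inr (Sum.inl (occ o).1)) (Sum.inl (o.2.1, Sum.inr (o.1, o.2.2)))
      = ((occ o).2 : ℕ) := by
  have key : ∀ z, ((Sum.inl (o.2.1, Sum.inr (o.1, o.2.2)) : TSt r) =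
      slotSt r s occ (occ o).1 z) ↔ (occ o).2 = z := by
    intro z
    constructor
    · intro h
      simp only [slotSt, Sum.inl.injEq, Prod.mk.injEq, Sum.inr.injEq] at h
      have : o = occ.symm ((occ o).1, z) := by
        ext1
        · exact h.2.1
        · ext1
          · exact h.1
          · exact h.2.2
      rw [Equiv.eq_symm_apply] at this
      rw [this]
    · rintro rfl
      simp [slotSt]
  simp only [TInst, key]
  generalize (occ o).2 = z
  fin_cases z <;> simp

theorem rank_r2 (j : Fin s) : (TInst r s occ).rankC (Sum.inr (Sum.inl j)) (Sum.inr 1) = 3 := by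
  simp [TInst, slotSt]

theorem buildM_feasible (σ : Fin r → Bool) (m : Fin s → Fin 3) :
    (TInst r s occ).Feasible (buildM occ σ m) := by
  apply SMTI.feasible_of _ (fun _ _ => rfl)
  rintro (⟨i, k⟩ | j | k)
  · by_cases hσ : (σ i = true ↔ k = 0)
    · refine ⟨{Sum.inl (i, Sum.inl 0), Sum.inl (i, Sum.inl 1)}, ?_, ?_, ?_⟩
      · intro u hu
        have hacc := buildM_matching (occ := occ) σ m _ _ hu
        fin_cases k
        · rcases acc_w hacc with rfl | rfl | rfl | rfl <;> simp_all [buildM]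
        · rcases acc_p hacc with rfl | rfl | rfl | rfl <;> simp_all [buildM]
      · simp [TInst]
      · intro z; fin_cases z <;> simp [TInst]
    · refine ⟨{Sum.inl (i, Sum.inr (decide (k = 0), 0)),
        Sum.inl (i, Sum.inr (decide (k = 0), 1))}, ?_, ?_, ?_⟩
      · intro u hu
        have hacc := buildM_matching (occ := occ) σ m _ _ hu
        fin_cases k
        · rcases acc_w hacc with rfl | rfl | rfl | rfl <;> simp_all [buildM]
        · rcases acc_p hacc with rfl | rfl | rfl | rfl <;> simp_all [buildM]
      · simp [TInst]
      · intro z; fin_cases z <;> simp [TInst]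
  · refine ⟨{slotSt r s occ j (m j)}, ?_, ?_, ?_⟩
    · intro u hu
      rcases acc_c (buildM_matching (occ := occ) σ m _ _ hu) with rfl | ⟨pol, i, z, h, rfl⟩
      · simp [buildM] at hu
      · simp only [buildM] at hu
        split_ifs at hu with h1 h2
        · subst h
          simp [slotSt, h2]
        all_goals simp at hu
    · simp [TInst]
    · intro z
      simp [TInst, slotSt]
      exact Bool.toNat_le _
  · fin_cases k
    · refine ⟨{Sum.inr 1}, ?_, ?_, ?_⟩
      · intro u hu
        rcases acc_s (buildM_matching (occ := occ) σ m _ _ hu) with rfl | rfl | rfl <;>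
          simp_all [buildM]
      · simp [TInst]
      · intro z; fin_cases z <;> simp [TInst]
    · refine ⟨{Sum.inr 0, Sum.inr 2}, ?_, ?_, ?_⟩
      · intro u hu
        rcases acc_s (buildM_matching (occ := occ) σ m _ _ hu) with rfl | rfl | rfl <;>
          simp_all [buildM]
      · simp [TInst]
      · intro z; fin_cases z <;> simp [TInst]

/-- The student in the chosen slot is at its clause college. -/
theorem buildM_slot (σ : Fin r → Bool) (m : Fin s → Fin 3)
    (hm : ∀ j, σ (occ.symm (j, m j)).2.1 = (occ.symm (j, m j)).1) (j : Fin s) :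
    buildM occ σ m (slotSt r s occ j (m j)) = some (Sum.inr (Sum.inl j)) := by
  simp [buildM, slotSt, hm j]

theorem rank_slot' (j : Fin s) (z : Fin 3) :
    (TInst r s occ).rankC (Sum.inr (Sum.inl j)) (slotSt r s occ j z) = (z : ℕ) := by
  have := rank_slot (occ := occ) (occ.symm (j, z))
  simpa [slotSt] using this

theorem buildM_stable (σ : Fin r → Bool) (m : Fin s → Fin 3)
    (hm : ∀ j, σ (occ.symm (j, m j)).2.1 = (occ.symm (j, m j)).1)
    (hmin : ∀ j z, σ (occ.symm (j, z)).2.1 = (occ.symm (j, z)).1 → m j ≤ z) :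
    (TInst r s occ).Stable (buildM occ σ m) := by
  intro u w hb
  have hclause : ∀ j, w = Sum.inr (Sum.inl j) →
      (m j : ℕ) ≤ (TInst r s occ).rankC (Sum.inr (Sum.inl j)) u → False := by
    rintro j rfl h
    have := (SMTI.keep_of_blocks _ hb {slotSt r s occ j (m j)} (by
      intro u' hu'
      rw [Finset.mem_singleton] at hu'
      subst hu'
      exact ⟨buildM_slot σ m hm j, by rw [rank_slot']; exact h⟩)).1
    simp [TInst] at this
  obtain ⟨U', hne, hacc, hp, -⟩ := id hb
  rcases u with ⟨i, k | ⟨pol, z⟩⟩ | k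
  · cases hσ : σ i
    · have hfu : ∀ k, buildM occ σ m (Sum.inl (i, Sum.inl k)) = some (Sum.inl (i, 1)) := by
        simp [buildM, hσ]
      have hp' := hp _ (hfu k)
      rcases hacc with rfl | rfl
      · fin_cases k
        · simp [TInst] at hp'
        · have := (SMTI.keep_of_blocks _ hb {Sum.inl (i, Sum.inr (true, 0))}
            (by simp [buildM, hσ, TInst])).2 1
          simp [TInst] at this
      · exact hne (hfu k)
    · have hfu : ∀ k, buildM occ σ m (Sum.inl (i, Sum.inl k)) = some (Sum.inl (i, 0)) := by
        simp [buildM, hσ]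
      have hp' := hp _ (hfu k)
      rcases hacc with rfl | rfl
      · exact hne (hfu k)
      · fin_cases k
        · have := (SMTI.keep_of_blocks _ hb {Sum.inl (i, Sum.inr (false, 0))}
            (by simp [buildM, hσ, TInst])).2 0
          simp [TInst] at this
        · simp [TInst] at hp'
  · by_cases hσ : σ i = pol
    · rcases hacc with rfl | rfl
      · cases pol
        · fin_cases z
          · have := (SMTI.keep_of_blocks _ hb {Sum.inl (i, Sum.inl 1)}
              (by simp [buildM, hσ, TInst])).2 1
            simp [TInst] at this
          · have := (SMTI.keep_of_blocks _ hb {Sum.inl (i, Sum.inl 0), Sum.inl (i, Sum.inl 1)}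
              (by simp [buildM, hσ, TInst])).1
            simp [TInst] at this
        · fin_cases z
          · have := (SMTI.keep_of_blocks _ hb {Sum.inl (i, Sum.inl 0)}
              (by simp [buildM, hσ, TInst])).2 0
            simp [TInst] at this
          · have := (SMTI.keep_of_blocks _ hb {Sum.inl (i, Sum.inl 0), Sum.inl (i, Sum.inl 1)}
              (by simp [buildM, hσ, TInst])).1
            simp [TInst] at this
      · apply hclause _ rfl
        have h1 := rank_slot (occ := occ) (pol, i, z)
        simp only at h1
        rw [h1]
        exact hmin _ _ (by simpa using hσ)
    · have hfu : buildM occ σ m (Sum.inl (i, Sum.inr (pol, z))) =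
          some (Sum.inl (i, if pol then 0 else 1)) := by
        simp [buildM, hσ]
      have hp' := hp _ hfu
      simp [TInst] at hp'
  · fin_cases k
    · have hp' := hp (Sum.inr (Sum.inr 1)) (by simp [buildM])
      simp [TInst] at hp'
    · simp only [TInst] at hacc
      rcases hacc with rfl | rfl | ⟨j, rfl⟩
      · exact hne (by simp [buildM])
      · have := (SMTI.keep_of_blocks _ hb {Sum.inr 2} (by simp [buildM, TInst])).2 1
        simp [TInst] at this
      · apply hclause _ rfl
        have h1 := rank_r2 (occ := occ) j
        have h2 := (m j).isLt
        simp only [Fin.mk_one] at h1 ⊢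
        omega
    · simp only [TInst] at hacc
      rcases hacc with rfl | rfl
      · have := (SMTI.keep_of_blocks _ hb {Sum.inr 1} (by simp [buildM, TInst])).1
        simp [TInst] at this
      · exact hne (by simp [buildM])

end Helpers

/-- A (2,2)-3SAT formula `φ` (with clause slots `cl` and
occurrence bijection `occ`) is satisfiable iff the constructed SMI-Diverse
instance admits a feasible and stable matching. -/
theorem stmt9 (r s : ℕ) (cl : Fin s → Fin 3 → Bool × Fin r)
    (occ : Bool × Fin r × Fin 2 ≃ Fin s × Fin 3)
    (hocc : ∀ (pol : Bool) (i : Fin r) (z : Fin 2),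
      cl (occ (pol, i, z)).1 (occ (pol, i, z)).2 = (pol, i)) :
    (∃ σ : Fin r → Bool, ∀ j : Fin s, ∃ z : Fin 3, σ (cl j z).2 = (cl j z).1) ↔
      ∃ f : TSt r → Option (TCo r s),
        (TInst r s occ).IsMatching f ∧ (TInst r s occ).Feasible f ∧
        (TInst r s occ).Stable f := by
  have hcl : ∀ j z, cl j z = ((occ.symm (j, z)).1, (occ.symm (j, z)).2.1) := by
    intro j z
    have := hocc (occ.symm (j, z)).1 (occ.symm (j, z)).2.1 (occ.symm (j, z)).2.2
    simpa using this
  constructor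
  · rintro ⟨σ, hσ⟩
    have hex : ∀ j, ∃ z : Fin 3, σ (occ.symm (j, z)).2.1 = (occ.symm (j, z)).1 ∧
        ∀ z', σ (occ.symm (j, z')).2.1 = (occ.symm (j, z')).1 → z ≤ z' := by
      intro j
      obtain ⟨z, hz⟩ := hσ j
      rw [hcl] at hz
      let P : Fin 3 → Prop := fun z => σ (occ.symm (j, z)).2.1 = (occ.symm (j, z)).1
      obtain ⟨z0, h0, hmin⟩ := WellFounded.has_min (wellFounded_lt (α := Fin 3)) {z | P z} ⟨z, hz⟩
      exact ⟨z0, h0, fun z' hz' => not_lt.mp (hmin z' hz')⟩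
    choose m hm hmin using hex
    exact ⟨buildM occ σ m, buildM_matching σ m, buildM_feasible σ m, buildM_stable σ m hm hmin⟩
  · rintro ⟨f, hm, hf, hs⟩
    refine ⟨fun i => decide (f (Sum.inl (i, Sum.inl 0)) = some (Sum.inl (i, 0))), fun j => ?_⟩
    obtain ⟨pol, i, z, hj, hu⟩ := clause_filled hm hf hs j
    refine ⟨(occ (pol, i, z)).2, ?_⟩
    subst hj
    rw [hocc]
    cases pol
    · simpa using neg_case hm hf hs i z _ hu
    · simpa using pos_case hm hf hs i z _ hu
end
end

section
/- An SMTI-Diverse instance admits a feasible matching if and only if there exist nonnegative integers x_{w,τ,A}, one for each college w ∈ W and each pair (τ, A) with τ ∈ {0,1}^t, A ⊆ W, w ∈ A, and S_{τ,A} ≠ ∅, satisfying: (a) for every such pair (τ, A), Σ_{w ∈ A} x_{w,τ,A} ≤ |S_{τ,A}|; (b) for every college w, Σ_{(τ,A) : w ∈ A, S_{τ,A} ≠ ∅} x_{w,τ,A} ≤ q_w; and (c) for every college w and every type z ∈ [t], ℓ_w[z] ≤ Σ_{(τ,A) : w ∈ A, S_{τ,A} ≠ ∅, τ[z] = 1}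 x_{w,τ,A} ≤ u_w[z]. -/
open scoped Classical

noncomputable section

namespace SMTI

variable {S C T : Type} [Fintype S] [Fintype C] [Fintype T]

/-- The acceptable set `A(u)` of a student, as a finset. -/
def accSet (I : SMTI S C T) (u : S) : Finset C :=
  Finset.univ.filter fun w => I.acc u w

/-- The students with type vector `tv` and acceptable set `A`. -/
def group (I : SMTI S C T) (tv : T → Bool) (A : Finset C) : Finset S :=
  Finset.univ.filter fun u => I.tau u = tv ∧ I.accSet u = A

/-- The (nonempty) pairs `(τ, A)` that actually occur among the students. -/
def pairs (I : SMTI S C T) : Finset ((T → Bool) × Finset C) :=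
  Finset.univ.image fun u : S => (I.tau u, I.accSet u)

end SMTI

namespace SMTI

/-- Distribute members of `G` over the colleges in `A` with prescribed numbers. -/
theorem exists_distribution {S C : Type} (A : Finset C) (x : C → ℕ) :
    ∀ G : Finset S, ∑ w ∈ A, x w ≤ G.card →
      ∃ g : S → Option C, (∀ u w, g u = some w → w ∈ A) ∧
        ∀ w ∈ A, (G.filter fun u => g u = some w).card = x w := by
  induction A using Finset.induction_on with
  | empty =>
    intro G _
    exact ⟨fun _ => none, by simp, by simp⟩
  | insert a A ha ih =>
    intro G hG
    rw [Finset.sum_insert ha] at hG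
    obtain ⟨H, hHG, hH⟩ := Finset.exists_subset_card_eq (s := G) (n := x a) (by omega)
    obtain ⟨g, hg1, hg2⟩ := ih (G \ H) (by rw [Finset.card_sdiff_of_subset hHG]; omega)
    refine ⟨fun u => if u ∈ H then some a else g u, ?_, ?_⟩
    · intro u w h
      by_cases hu : u ∈ H
      · simp [hu] at h
        simp [h]
      · simp [hu] at h
        exact Finset.mem_insert_of_mem (hg1 u w h)
    · intro w hw
      rcases Finset.mem_insert.1 hw with rfl | hwA
      · rw [← hH]
        congr 1
        ext u
        by_cases hu : u ∈ H
        · simp [hu, hHG hu]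
        · simp only [hu, if_false, Finset.mem_filter, iff_false, not_and]
          intro _ h
          exact ha (hg1 u _ h)
      · rw [← hg2 w hwA]
        congr 1
        ext u
        by_cases hu : u ∈ H
        · have : a ≠ w := fun h => ha (h ▸ hwA)
          simp [hu, this]
        · simp [hu]

variable {S C T : Type} [Fintype S] [Fintype C] [Fintype T]

/-- The number of students of group `(tv, A)` assigned to `w`. -/
def cnt (I : SMTI S C T) (f : S → Option C) (w : C) (tv : T → Bool) (A : Finset C) : ℕ :=
  ((I.group tv A).filter fun u => f u = some w).card

theorem card_assigned (I : SMTI S C T) (f : S → Option C) (hf : I.IsMatching f) (w : C) :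
    (I.assigned f w).card =
      ∑ p ∈ I.pairs.filter (fun p => w ∈ p.2), I.cnt f w p.1 p.2 := by
  rw [Finset.card_eq_sum_card_fiberwise (f := fun u => (I.tau u, I.accSet u))
    (t := I.pairs.filter (fun p => w ∈ p.2))]
  · refine Finset.sum_congr rfl fun p _ => ?_
    unfold cnt
    congr 1
    ext u
    simp [assigned, group, Prod.ext_iff]
    tauto
  · intro u hu
    have hu' : f u = some w := by simpa [assigned] using hu
    simpa [pairs, accSet] using And.intro ⟨u, rfl, rfl⟩ (hf u w hu')

theorem typeLoad_eq (I : SMTI S C T) (f : S → Option C) (hf : I.IsMatching f) (w : C) (z : T) :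
    I.typeLoad f w z =
      ∑ p ∈ I.pairs.filter (fun p => w ∈ p.2 ∧ p.1 z = true), I.cnt f w p.1 p.2 := by
  have h1 : I.typeLoad f w z = ((I.assigned f w).filter fun u => I.tau u z = true).card := by
    rw [typeLoad, Finset.card_filter]
    refine Finset.sum_congr rfl fun u _ => ?_
    cases I.tau u z <;> simp
  rw [h1, Finset.card_eq_sum_card_fiberwise (f := fun u => (I.tau u, I.accSet u))
    (t := I.pairs.filter (fun p => w ∈ p.2 ∧ p.1 z = true))]
  · refine Finset.sum_congr rfl fun p hp => ?_
    have hz : p.1 z = true := (Finset.mem_filter.1 hp).2.2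
    unfold cnt
    congr 1
    ext u
    simp only [assigned, group, Prod.ext_iff, Finset.mem_filter, Finset.mem_univ, true_and]
    constructor
    · rintro ⟨⟨h1, h2⟩, h3⟩
      exact ⟨h3, h1⟩
    · rintro ⟨h3, h1⟩
      exact ⟨⟨h1, by rw [h3.1]; exact hz⟩, h3⟩
  · intro u hu
    have hu' : f u = some w ∧ I.tau u z = true := by simpa [assigned] using hu
    have hw : w ∈ I.accSet u := by simpa [accSet] using hf u w hu'.1
    exact Finset.mem_coe.2 (Finset.mem_filter.2
      ⟨Finset.mem_image_of_mem _ (Finset.mem_univ u), hw, hu'.2⟩)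

end SMTI

/-- An instance admits a feasible matching iff the natural
integer program has a solution: nonnegative integers `x w τ A` (for `w ∈ A` and
`S_{τ,A} ≠ ∅`) such that (a) for every occurring pair `(τ,A)`,
`Σ_{w ∈ A} x w τ A ≤ |S_{τ,A}|`; (b) for every college `w`, the total over pairs
with `w ∈ A` is at most `q_w`; (c) for every college `w` and type `z`,
the total over pairs with `w ∈ A` and `τ[z] = 1` lies between `ℓ_w[z]` and `u_w[z]`. -/
theorem stmt14 {S C T : Type} [Fintype S] [Fintype C] [Fintype T]
    (I : SMTI S C T) :
    (∃ f : S → Option C, I.IsMatching f ∧ I.Feasible f) ↔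
      ∃ x : C → (T → Bool) → Finset C → ℕ,
        (∀ u : S, ∑ w ∈ I.accSet u, x w (I.tau u) (I.accSet u)
            ≤ (I.group (I.tau u) (I.accSet u)).card) ∧
        (∀ w : C, ∑ p ∈ I.pairs.filter (fun p => w ∈ p.2), x w p.1 p.2 ≤ I.cap w) ∧
        (∀ (w : C) (z : T),
          I.lq w z ≤ ∑ p ∈ I.pairs.filter (fun p => w ∈ p.2 ∧ p.1 z = true), x w p.1 p.2 ∧
          ∑ p ∈ I.pairs.filter (fun p => w ∈ p.2 ∧ p.1 z = true), x w p.1 p.2 ≤ I.uq w z) := by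
  constructor
  · rintro ⟨f, hf, hF⟩
    refine ⟨I.cnt f, ?_, ?_, ?_⟩
    · intro u
      unfold SMTI.cnt
      rw [← Finset.card_biUnion]
      · exact Finset.card_le_card (Finset.biUnion_subset.2 fun w _ => Finset.filter_subset _ _)
      · intro w _ w' _ hne
        refine Finset.disjoint_left.2 fun v hv hv' => hne ?_
        have h1 := (Finset.mem_filter.1 hv).2
        have h2 := (Finset.mem_filter.1 hv').2
        exact Option.some.inj (h1.symm.trans h2)
    · intro w
      rw [← I.card_assigned f hf]
      exact (hF w).1
    · intro w z
      rw [← I.typeLoad_eq f hf]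
      exact (hF w).2 z
  · rintro ⟨x, ha, hb, hc⟩
    have key : ∀ p : (T → Bool) × Finset C, ∃ g : S → Option C, p ∈ I.pairs →
        (∀ u w, g u = some w → w ∈ p.2) ∧
        ∀ w ∈ p.2, ((I.group p.1 p.2).filter fun u => g u = some w).card = x w p.1 p.2 := by
      intro p
      by_cases hp : p ∈ I.pairs
      · obtain ⟨u, -, rfl⟩ := Finset.mem_image.1 hp
        obtain ⟨g, hg⟩ := SMTI.exists_distribution (I.accSet u)
          (fun w => x w (I.tau u) (I.accSet u)) _ (ha u)
        exact ⟨g, fun _ => hg⟩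
      · exact ⟨fun _ => none, fun h => absurd h hp⟩
    choose g hg using key
    have hf : I.IsMatching (fun u => g (I.tau u, I.accSet u) u) := by
      intro u w h
      have := (hg (I.tau u, I.accSet u)
        (Finset.mem_image_of_mem _ (Finset.mem_univ u))).1 u w h
      simpa [SMTI.accSet] using this
    have hcnt : ∀ w, ∀ p ∈ I.pairs, w ∈ p.2 →
        I.cnt (fun u => g (I.tau u, I.accSet u) u) w p.1 p.2 = x w p.1 p.2 := by
      intro w p hp hw
      rw [← (hg p hp).2 w hw, SMTI.cnt]
      congr 1
      refine Finset.filter_congr fun u hu => ?_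
      have hu' : I.tau u = p.1 ∧ I.accSet u = p.2 := by simpa [SMTI.group] using hu
      rw [hu'.1, hu'.2]
    refine ⟨_, hf, fun w => ⟨?_, fun z => ?_⟩⟩
    · rw [I.card_assigned _ hf]
      refine le_trans (le_of_eq (Finset.sum_congr rfl fun p hp => ?_)) (hb w)
      exact hcnt w p (Finset.mem_filter.1 hp).1 (Finset.mem_filter.1 hp).2
    · rw [I.typeLoad_eq _ hf, Finset.sum_congr rfl fun p hp =>
        hcnt w p (Finset.mem_filter.1 hp).1 (Finset.mem_filter.1 hp).2.1]
      exact hc w z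
end
end
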